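/- Let U be a multivalued process on a complete metric space X possessing a pullback attractor A = {A(t)}, and assume U is forward asymptotically compact. If ω_f(B,t₀) ⊆ ω₀(A) for every bounded set B ⊆ X and every t₀ ∈ ℝ, then A is a forward attractor and ω(A) = ω₀(A). -/

import Mathlib

open Filter Topology Set Metric Bornology ENNReal

variable {X : Type*} [MetricSpace X]

/-- Hausdorff semidistance `dist(A,B) = sup_{a ∈ A} inf_{b ∈ B} d(a,b)`,
valued in `ℝ≥0∞`. -/
noncomputable def esemidist (A B : Set X) : ℝ≥0∞ :=
  ⨆ a : A, EMetric.infEdist (a : X) B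

/-- Hausdorff distance `dist_H(A,B) = max{dist(A,B), dist(B,A)}`. -/
noncomputable def ehdist (A B : Set X) : ℝ≥0∞ :=
  max (esemidist A B) (esemidist B A)

/-- Image of a set `B` under a multivalued map `U(t,s,·)`. -/
def MImage (U : ℝ → ℝ → X → Set X) (t s : ℝ) (B : Set X) : Set X :=
  ⋃ x ∈ B, U t s x

/-- A multivalued process on `X`: `U(s,s,x) = {x}`, each value is nonempty and
`U(t,s,x) ⊆ U(t,τ,U(τ,s,x))` for `s ≤ τ ≤ t`. -/
def IsMultiProcess (U : ℝ → ℝ → X → Set X) : Prop :=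
  (∀ (s : ℝ) (x : X), U s s x = {x}) ∧
  (∀ (t s : ℝ) (x : X), s ≤ t → (U t s x).Nonempty) ∧
  (∀ (t τ s : ℝ) (x : X), s ≤ τ → τ ≤ t → U t s x ⊆ MImage U t τ (U τ s x))

/-- The multivalued process `U` is forward asymptotically compact. -/
def MFwdAsympCompact (U : ℝ → ℝ → X → Set X) : Prop :=
  ∀ (t₀ : ℝ) (B : Set X), IsBounded B →
    ∀ (t : ℕ → ℝ) (y : ℕ → X), Tendsto t atTop atTop →
      (∀ n, t₀ ≤ t n ∧ y n ∈ MImage U (t n) t₀ B) →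
      ∃ (φ : ℕ → ℕ) (z : X), StrictMono φ ∧ Tendsto (y ∘ φ) atTop (𝓝 z)

/-- Forward ω-limit set `ω_f(B,t₀)` of a set `B` for initial time `t₀`. -/
def MomegaF (U : ℝ → ℝ → X → Set X) (B : Set X) (t₀ : ℝ) : Set X :=
  {y | ∃ (t : ℕ → ℝ) (yn : ℕ → X), Tendsto t atTop atTop ∧
        (∀ n, t₀ ≤ t n ∧ yn n ∈ MImage U (t n) t₀ B) ∧ Tendsto yn atTop (𝓝 y)}

/-- ω-limit set `ω(K)` of a family of sets `K = {K(t)}`. -/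
def omegaFam (K : ℝ → Set X) : Set X :=
  {y | ∃ (t : ℕ → ℝ) (yn : ℕ → X), Tendsto t atTop atTop ∧
        (∀ n, yn n ∈ K (t n)) ∧ Tendsto yn atTop (𝓝 y)}

/-- The set `ω₀(K) = Liminf_{t → +∞} K(t)`. -/
def omega0Fam (K : ℝ → Set X) : Set X :=
  {y | Tendsto (fun t => EMetric.infEdist y (K t)) atTop (𝓝 0)}

/-- The family `C = {C(t)}` pullback attracts every bounded set. -/
def MPullbackAttracts (U : ℝ → ℝ → X → Set X) (C : ℝ → Set X) : Prop :=
  ∀ (t : ℝ) (B : Set X), IsBounded B →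
    Tendsto (fun t₀ => esemidist (MImage U t t₀ B) (C t)) atBot (𝓝 0)

/-- A pullback attractor for a multivalued process: a family of nonempty compact
negatively invariant sets which pullback attracts every bounded set and is
minimal among closed pullback attracting families. -/
def MIsPullbackAttractor (U : ℝ → ℝ → X → Set X) (A : ℝ → Set X) : Prop :=
  (∀ t, (A t).Nonempty) ∧ (∀ t, IsCompact (A t)) ∧
  (∀ t s : ℝ, s ≤ t → A t ⊆ MImage U t s (A s)) ∧
  MPullbackAttracts U A ∧
  (∀ C : ℝ → Set X, (∀ t, IsClosed (C t)) → MPullbackAttracts U C → ∀ t, A t ⊆ C t)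

/-- The family `A = {A(t)}` forward attracts every bounded set. -/
def MForwardAttracts (U : ℝ → ℝ → X → Set X) (A : ℝ → Set X) : Prop :=
  ∀ (t₀ : ℝ) (B : Set X), IsBounded B →
    Tendsto (fun t => esemidist (MImage U t t₀ B) (A t)) atTop (𝓝 0)

/-- A forward attractor for a multivalued process: a family of nonempty compact
negatively invariant sets which forward attracts every bounded set. -/
def MIsForwardAttractor (U : ℝ → ℝ → X → Set X) (A : ℝ → Set X) : Prop :=
  (∀ t, (A t).Nonempty) ∧ (∀ t, IsCompact (A t)) ∧
  (∀ t s : ℝ, s ≤ t → A t ⊆ MImage U t s (A s)) ∧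
  MForwardAttracts U A

theorem MForwardAttracts.of_omegaF_subset_omega0 {U : ℝ → ℝ → X → Set X} {A : ℝ → Set X}
    (hFC : MFwdAsympCompact U)
    (h : ∀ B : Set X, IsBounded B → ∀ t₀ : ℝ, MomegaF U B t₀ ⊆ omega0Fam A) :
    MForwardAttracts U A := by
  intro t₀ B hB
  rw [ENNReal.tendsto_nhds_zero]
  intro ε hε
  by_contra hcon
  have hfreq : ∃ᶠ t in atTop, t₀ ≤ t ∧ ∃ y ∈ MImage U t t₀ B, ε < Metric.infEDist y (A t) := by
    refine ((not_eventually.1 hcon).and_eventually (eventually_ge_atTop t₀)).mono ?_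
    rintro t ⟨ht, ht₀⟩
    obtain ⟨y, hy⟩ := lt_iSup_iff.1 (not_le.1 ht)
    exact ⟨ht₀, y, y.2, hy⟩
  obtain ⟨t, ht, hP⟩ := exists_seq_forall_of_frequently hfreq
  choose ht₀ y hy hdist using hP
  obtain ⟨φ, z, hφ, hz⟩ := hFC t₀ B hB t y ht fun n => ⟨ht₀ n, hy n⟩
  have htφ : Tendsto (t ∘ φ) atTop atTop := ht.comp hφ.tendsto_atTop
  have hz₀ : z ∈ omega0Fam A :=
    h B hB t₀ ⟨t ∘ φ, y ∘ φ, htφ, fun n => ⟨ht₀ (φ n), hy (φ n)⟩, hz⟩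
  have hsum : Tendsto
      (fun n => Metric.infEDist z (A (t (φ n))) + edist (y (φ n)) z) atTop (𝓝 0) := by
    rw [← add_zero 0]
    exact (Tendsto.comp hz₀ htφ).add (tendsto_iff_edist_tendsto_0.1 hz)
  obtain ⟨n, hn⟩ := (hsum.eventually (gt_mem_nhds hε)).exists
  exact lt_asymm (hdist (φ n)) (Metric.infEDist_le_infEDist_add_edist.trans_lt hn)

theorem omegaFam_subset_MomegaF {U : ℝ → ℝ → X → Set X} {A : ℝ → Set X} {t₀ : ℝ}
    (hinv : ∀ t, t₀ ≤ t → A t ⊆ MImage U t t₀ (A t₀)) :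
    omegaFam A ⊆ MomegaF U (A t₀) t₀ := by
  rintro y ⟨t, yn, ht, hyn, hy⟩
  obtain ⟨N, hN⟩ := eventually_atTop.1 (ht.eventually_ge_atTop t₀)
  have ht₀ (n : ℕ) : t₀ ≤ t (n + N) := hN _ (Nat.le_add_left N n)
  exact ⟨fun n => t (n + N), fun n => yn (n + N), ht.comp (tendsto_add_atTop_nat N),
    fun n => ⟨ht₀ n, hinv _ (ht₀ n) (hyn _)⟩, hy.comp (tendsto_add_atTop_nat N)⟩

theorem omega0Fam_subset_omegaFam {A : ℝ → Set X} (hne : ∀ t, (A t).Nonempty)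
    (hcomp : ∀ t, IsCompact (A t)) : omega0Fam A ⊆ omegaFam A := by
  intro y hy
  choose p hpA hp using fun t => (hcomp t).exists_infEDist_eq_edist (hne t) y
  refine ⟨fun n => n, fun n => p n, tendsto_natCast_atTop_atTop, fun n => hpA n, ?_⟩
  rw [tendsto_iff_edist_tendsto_0]
  refine (Tendsto.comp hy tendsto_natCast_atTop_atTop).congr fun n => ?_
  rw [edist_comm]
  exact hp n

/-- If the multivalued process `U` has a pullback attractor `A`,
is forward asymptotically compact, and `ω_f(B,t₀) ⊆ ω₀(A)` for every bounded
`B` and every `t₀`, then `A` is a forward attractor and `ω(A) = ω₀(A)`. -/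
theorem mForwardAttractor_of_omegaF_subset_omega0 [CompleteSpace X]
    (U : ℝ → ℝ → X → Set X) (hU : IsMultiProcess U)
    (A : ℝ → Set X) (hA : MIsPullbackAttractor U A)
    (hFC : MFwdAsympCompact U)
    (h : ∀ B : Set X, IsBounded B → ∀ t₀ : ℝ, MomegaF U B t₀ ⊆ omega0Fam A) :
    MIsForwardAttractor U A ∧ omegaFam A = omega0Fam A := by
  obtain ⟨hne, hcomp, hinv, -, -⟩ := hA
  refine ⟨⟨hne, hcomp, hinv, .of_omegaF_subset_omega0 hFC h⟩,
    Subset.antisymm ?_ (omega0Fam_subset_omegaFam hne hcomp)⟩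
  exact (omegaFam_subset_MomegaF fun t ht => hinv t 0 ht).trans (h _ (hcomp 0).isBounded 0)
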